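/- arXiv:1402.5772 — 2 statements merged into one kernel-verified Lean document; each statement's English description precedes it below -/
import Mathlib

section
/- Let n ∈ {2,3} and α = n/4. There exists a constant c > 0 such that for all smooth compactly supported vector fields u, v, w : ℝⁿ → ℝⁿ one has |b₁(u, v, w)| ≤ c · ‖u‖_{L²}^{1−α} · ‖u‖_{H¹}^{α} · ‖∇v‖_{L²}^{1−α} · ‖D²v‖_{L²}^{α} · ‖w‖_{L²}. -/
open MeasureTheory

/-- The trilinear form `b₁(u,v,w) = Σ_{i,j} ∫_{ℝⁿ} uⁱ ∂ᵢvʲ wʲ`. -/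
noncomputable def b1 {n : ℕ} (u v w : (Fin n → ℝ) → (Fin n → ℝ)) : ℝ :=
  ∑ i : Fin n, ∑ j : Fin n,
    ∫ x : Fin n → ℝ, u x i * fderiv ℝ v x (Pi.single i 1) j * w x j

/-- `‖u‖_{L²}²` of a vector field. -/
noncomputable def l2SqV {n : ℕ} (u : (Fin n → ℝ) → (Fin n → ℝ)) : ℝ :=
  ∫ x : Fin n → ℝ, ∑ j : Fin n, (u x j) ^ 2

/-- `‖∇u‖_{L²}²` of a vector field (Frobenius norm of the Jacobian pointwise). -/
noncomputable def gradSqV {n : ℕ} (u : (Fin n → ℝ) → (Fin n → ℝ)) : ℝ :=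
  ∫ x : Fin n → ℝ, ∑ i : Fin n, ∑ j : Fin n, (fderiv ℝ u x (Pi.single i 1) j) ^ 2

/-- `‖D²u‖_{L²}²` of a vector field (Frobenius norm of the Hessian pointwise). -/
noncomputable def hessSqV {n : ℕ} (u : (Fin n → ℝ) → (Fin n → ℝ)) : ℝ :=
  ∫ x : Fin n → ℝ, ∑ i : Fin n, ∑ j : Fin n, ∑ l : Fin n,
    (fderiv ℝ (fun y => fderiv ℝ u y (Pi.single i 1) l) x (Pi.single j 1)) ^ 2

theorem integrable_comp_of_hasCompactSupport {X F : Type*} [TopologicalSpace X] [MeasurableSpace X]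
    [OpensMeasurableSpace X] [TopologicalSpace F] [Zero F] {μ : Measure X}
    [IsFiniteMeasureOnCompacts μ] {f : X → F} (hf : Continuous f) (hfc : HasCompactSupport f)
    {g : F → ℝ} (hg : Continuous g) (hg0 : g 0 = 0) : Integrable (fun x => g (f x)) μ :=
  (hg.comp hf).integrable_of_hasCompactSupport (hfc.comp_left hg0)

theorem sq_integral_mul_le {X : Type*} [TopologicalSpace X] [MeasurableSpace X]
    [OpensMeasurableSpace X] {μ : Measure X} [IsFiniteMeasureOnCompacts μ] {f g : X → ℝ}
    (hf : Continuous f) (hfc : HasCompactSupport f) (hg : Continuous g)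
    (hgc : HasCompactSupport g) :
    (∫ x, f x * g x ∂μ) ^ 2 ≤ (∫ x, f x ^ 2 ∂μ) * ∫ x, g x ^ 2 ∂μ := by
  have hff : Integrable (fun x => f x ^ 2) μ :=
    integrable_comp_of_hasCompactSupport hf hfc (g := fun t => t ^ 2) (by fun_prop) (by simp)
  have hgg : Integrable (fun x => g x ^ 2) μ :=
    integrable_comp_of_hasCompactSupport hg hgc (g := fun t => t ^ 2) (by fun_prop) (by simp)
  have hfg : Integrable (fun x => f x * g x) μ :=
    (hf.mul hg).integrable_of_hasCompactSupport hfc.mul_right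
  have h := discrim_le_zero (a := ∫ x, g x ^ 2 ∂μ) (b := 2 * ∫ x, f x * g x ∂μ)
    (c := ∫ x, f x ^ 2 ∂μ) fun t => by
      have h0 : 0 ≤ ∫ x, (t * g x + f x) ^ 2 ∂μ := integral_nonneg fun x => sq_nonneg _
      have h1 : ∀ x, (t * g x + f x) ^ 2
          = (t * t) * g x ^ 2 + (2 * t) * (f x * g x) + f x ^ 2 := fun x => by ring
      simp_rw [h1] at h0
      have h2 : Integrable (fun x => (t * t) * g x ^ 2 + (2 * t) * (f x * g x)) μ :=
        (hgg.const_mul _).add (hfg.const_mul _)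
      rw [integral_add h2 hff, integral_add (hgg.const_mul _) (hfg.const_mul _),
        integral_const_mul, integral_const_mul] at h0
      linarith
  rw [discrim] at h
  nlinarith

theorem norm_fderiv_pow_eq {E : Type*} [NormedAddCommGroup E] [NormedSpace ℝ E] {f : E → ℝ} {x : E}
    (hf : DifferentiableAt ℝ f x) (m : ℕ) :
    ‖fderiv ℝ (fun y => f y ^ m) x‖ = m * |f x| ^ (m - 1) * ‖fderiv ℝ f x‖ := by
  rw [(hf.hasFDerivAt.pow m).fderiv, norm_smul]
  simp

/-- The real-valued form of the Gagliardo-Nirenberg-Sobolev inequality in `L¹`. -/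
theorem integral_rpow_le_rpow_integral_norm_fderiv {n : ℕ} {p : ℝ}
    (hp : Real.HolderConjugate n p) {f : (Fin n → ℝ) → ℝ} (hf : ContDiff ℝ 1 f)
    (hfc : HasCompactSupport f) :
    ∫ x, |f x| ^ p ≤ (∫ x, ‖fderiv ℝ f x‖) ^ p := by
  have hp0 : 0 < p := hp.symm.pos
  have h := lintegral_pow_le_pow_lintegral_fderiv_aux (ι := Fin n) (p := p) (by simpa using hp)
    hf hfc
  have hI : Integrable (fun x => |f x| ^ p) :=
    (hf.continuous.abs.rpow_const fun x => Or.inr hp0.le).integrable_of_hasCompactSupport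
      (hfc.comp_left (g := fun t : ℝ => |t| ^ p) (by simp [hp0.ne']))
  have hJ : Integrable (fun x => fderiv ℝ f x) :=
    (hf.continuous_fderiv one_ne_zero).integrable_of_hasCompactSupport (hfc.fderiv ℝ)
  rw [← ofReal_integral_norm_eq_lintegral_enorm hJ,
    ENNReal.ofReal_rpow_of_nonneg (by positivity) hp0.le] at h
  refine (ENNReal.ofReal_le_ofReal_iff (by positivity)).1 (le_trans (le_of_eq ?_) h)
  rw [ofReal_integral_eq_lintegral_ofReal hI (ae_of_all _ fun x => by positivity)]
  refine lintegral_congr fun x => ?_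
  rw [← ENNReal.ofReal_rpow_of_nonneg (abs_nonneg _) hp0.le, ← Real.norm_eq_abs, ofReal_norm]

/-- Ladyzhenskaya's inequality in the plane. -/
theorem integral_pow_four_le_two {f : (Fin 2 → ℝ) → ℝ} (hf : ContDiff ℝ 1 f)
    (hfc : HasCompactSupport f) :
    ∫ x, f x ^ 4 ≤ 4 * (∫ x, f x ^ 2) * ∫ x, ‖fderiv ℝ f x‖ ^ 2 := by
  have h := integral_rpow_le_rpow_integral_norm_fderiv (n := 2) (p := 2)
    (by rw [Real.holderConjugate_iff]; norm_num) (hf.pow 2)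
    (hfc.comp_left (g := fun t : ℝ => t ^ 2) (by simp))
  have hcs := sq_integral_mul_le (μ := volume) hf.continuous.abs hfc.norm
    (hf.continuous_fderiv one_ne_zero).norm (hfc.fderiv ℝ).norm
  simp_rw [norm_fderiv_pow_eq (hf.differentiable one_ne_zero _)] at h
  simp only [Real.rpow_two, sq_abs, ← pow_mul, Nat.cast_ofNat, Nat.add_one_sub_one, pow_one,
    mul_assoc, integral_const_mul] at h hcs
  norm_num at h
  linarith

/-- Ladyzhenskaya's inequality in space. -/
theorem sq_integral_pow_four_le_three {f : (Fin 3 → ℝ) → ℝ} (hf : ContDiff ℝ 1 f)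
    (hfc : HasCompactSupport f) :
    (∫ x, f x ^ 4) ^ 2 ≤ 4096 * (∫ x, f x ^ 2) * (∫ x, ‖fderiv ℝ f x‖ ^ 2) ^ 3 := by
  have h := integral_rpow_le_rpow_integral_norm_fderiv (n := 3) (p := 3 / 2)
    (by rw [Real.holderConjugate_iff]; norm_num) (hf.pow 4)
    (hfc.comp_left (g := fun t : ℝ => t ^ 4) (by simp))
  have hc3 : HasCompactSupport fun x => f x ^ 3 :=
    hfc.comp_left (g := fun t : ℝ => t ^ 3) (by simp)
  have hcs := sq_integral_mul_le (μ := volume) (f := fun x => |f x ^ 3|)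
    (hf.continuous.pow 3).abs hc3.norm
    (hf.continuous_fderiv one_ne_zero).norm (hfc.fderiv ℝ).norm
  have hcs' := sq_integral_mul_le (μ := volume) (g := fun x => f x ^ 3) hf.continuous hfc
    (hf.continuous.pow 3) hc3
  simp_rw [norm_fderiv_pow_eq (hf.differentiable one_ne_zero _)] at h
  have h6 : ∀ x, |f x ^ 4| ^ (3 / 2 : ℝ) = f x ^ 6 := fun x => by
    rw [abs_pow, ← Real.rpow_natCast, ← Real.rpow_mul (abs_nonneg _)]
    norm_num
    exact Even.pow_abs ⟨3, rfl⟩ _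
  have h4 : ∀ x, f x * f x ^ 3 = f x ^ 4 := fun x => by ring
  simp only [h6, Nat.cast_ofNat, Nat.add_one_sub_one, mul_assoc, integral_const_mul] at h
  simp only [h4, sq_abs, ← pow_mul, Nat.reduceMul] at hcs hcs'
  simp only [abs_pow] at hcs
  set S := ∫ x, f x ^ 6
  set J := ∫ x, |f x| ^ 3 * ‖fderiv ℝ f x‖
  set G := ∫ x, ‖fderiv ℝ f x‖ ^ 2
  set A := ∫ x, f x ^ 2
  have hS : 0 ≤ S := integral_nonneg fun x => by positivity
  have hJ : 0 ≤ J := integral_nonneg fun x => by positivity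
  have hG : 0 ≤ G := integral_nonneg fun x => by positivity
  have hA : 0 ≤ A := integral_nonneg fun x => by positivity
  have hSJ : S ^ 2 ≤ (4 * J) ^ 3 := by
    calc S ^ 2 ≤ ((4 * J) ^ (3 / 2 : ℝ)) ^ 2 := by gcongr
      _ = (4 * J) ^ 3 := by
        rw [← Real.rpow_natCast, ← Real.rpow_mul (by positivity), ← Real.rpow_natCast]
        norm_num
  have hSG : S ≤ 4096 * G ^ 3 := by
    rcases hS.eq_or_lt with h0 | h0
    · rw [← h0]; positivity
    · refine le_of_mul_le_mul_right ?_ (pow_pos h0 3)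
      calc S * S ^ 3 = (S ^ 2) ^ 2 := by ring
        _ ≤ ((4 * J) ^ 3) ^ 2 := by gcongr
        _ = 4096 * (J ^ 2) ^ 3 := by ring
        _ ≤ 4096 * (S * G) ^ 3 := by gcongr
        _ = 4096 * G ^ 3 * S ^ 3 := by ring
  calc _ ≤ A * S := hcs'
    _ ≤ A * (4096 * G ^ 3) := by gcongr
    _ = _ := by ring

/-- Ladyzhenskaya's inequality in dimensions two and three. -/
theorem sq_integral_pow_four_le {n : ℕ} (hn : n = 2 ∨ n = 3) {f : (Fin n → ℝ) → ℝ}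
    (hf : ContDiff ℝ 1 f) (hfc : HasCompactSupport f) :
    (∫ x, f x ^ 4) ^ 2 ≤
      4096 * (∫ x, f x ^ 2) ^ (4 - n) * (∫ x, ‖fderiv ℝ f x‖ ^ 2) ^ n := by
  have hG : 0 ≤ ∫ x, ‖fderiv ℝ f x‖ ^ 2 := integral_nonneg fun x => by positivity
  have hA : 0 ≤ ∫ x, f x ^ 2 := integral_nonneg fun x => by positivity
  rcases hn with rfl | rfl
  · calc _ ≤ (4 * (∫ x, f x ^ 2) * ∫ x, ‖fderiv ℝ f x‖ ^ 2) ^ 2 :=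
          pow_le_pow_left₀ (integral_nonneg fun x => by positivity)
            (integral_pow_four_le_two hf hfc) 2
      _ = 16 * ((∫ x, f x ^ 2) ^ 2 * (∫ x, ‖fderiv ℝ f x‖ ^ 2) ^ 2) := by ring
      _ ≤ 4096 * ((∫ x, f x ^ 2) ^ 2 * (∫ x, ‖fderiv ℝ f x‖ ^ 2) ^ 2) := by gcongr; norm_num
      _ = _ := by ring
  · simpa using sq_integral_pow_four_le_three hf hfc

theorem norm_sq_le_card_mul_sum_sq {n : ℕ} (L : (Fin n → ℝ) →L[ℝ] ℝ) :
    ‖L‖ ^ 2 ≤ n * ∑ k, L (Pi.single k 1) ^ 2 := by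
  have h : ‖L‖ ≤ ∑ k, |L (Pi.single k 1)| := by
    refine L.opNorm_le_bound (by positivity) fun x => ?_
    conv_lhs => rw [← Finset.univ_sum_single x, map_sum]
    rw [Finset.sum_mul]
    refine (norm_sum_le _ _).trans (Finset.sum_le_sum fun k _ => ?_)
    rw [show (Pi.single k (x k) : Fin n → ℝ) = x k • Pi.single k 1 by
      rw [← Pi.single_smul, smul_eq_mul, mul_one], map_smul, smul_eq_mul, norm_mul, mul_comm]
    gcongr
    · exact le_rfl
    · exact norm_le_pi_norm x k
  calc ‖L‖ ^ 2 ≤ (∑ k, |L (Pi.single k 1)|) ^ 2 := by gcongr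
    _ ≤ _ := by
      simpa using sq_sum_le_card_mul_sum_sq (s := Finset.univ) (f := fun k => |L (Pi.single k 1)|)

/-- Ladyzhenskaya's inequality with `‖∇f‖_{L²}` measured by the partial derivatives, in terms of
upper bounds for the norms involved. -/
theorem integral_pow_four_le_of_le {n : ℕ} (hn : n = 2 ∨ n = 3) {f : (Fin n → ℝ) → ℝ}
    (hf : ContDiff ℝ 1 f) (hfc : HasCompactSupport f) {A B : ℝ}
    (hA : ∫ x, f x ^ 2 ≤ A) (hB : ∫ x, ∑ k, fderiv ℝ f x (Pi.single k 1) ^ 2 ≤ B) :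
    ∫ x, f x ^ 4 ≤ 512 * (√A ^ (1 - (n : ℝ) / 4) * √B ^ ((n : ℝ) / 4)) ^ 4 := by
  have hA0 : 0 ≤ ∫ x, f x ^ 2 := integral_nonneg fun x => by positivity
  have hB0 : 0 ≤ ∫ x, ∑ k, fderiv ℝ f x (Pi.single k 1) ^ 2 :=
    integral_nonneg fun x => by positivity
  have hG0 : 0 ≤ ∫ x, ‖fderiv ℝ f x‖ ^ 2 := integral_nonneg fun x => by positivity
  have hG : ∫ x, ‖fderiv ℝ f x‖ ^ 2 ≤ 3 * B := by
    have hc := hf.continuous_fderiv one_ne_zero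
    calc ∫ x, ‖fderiv ℝ f x‖ ^ 2
        ≤ ∫ x, 3 * ∑ k, fderiv ℝ f x (Pi.single k 1) ^ 2 := by
          refine integral_mono
            (integrable_comp_of_hasCompactSupport hc (hfc.fderiv ℝ) (g := fun L => ‖L‖ ^ 2)
              (by fun_prop) (by simp))
            (integrable_comp_of_hasCompactSupport hc (hfc.fderiv ℝ)
              (g := fun L => 3 * ∑ k, L (Pi.single k 1) ^ 2) (by fun_prop) (by simp))
            fun x => (norm_sq_le_card_mul_sum_sq _).trans ?_
          have : (n : ℝ) ≤ 3 := by rcases hn with rfl | rfl <;> norm_num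
          exact mul_le_mul_of_nonneg_right this (by positivity)
      _ ≤ 3 * B := by rw [integral_const_mul]; gcongr
  have hA' := hA0.trans hA
  have hB' := hB0.trans hB
  refine le_of_sq_le_sq ?_ (by positivity)
  calc (∫ x, f x ^ 4) ^ 2
      ≤ 4096 * (∫ x, f x ^ 2) ^ (4 - n) * (∫ x, ‖fderiv ℝ f x‖ ^ 2) ^ n :=
        sq_integral_pow_four_le hn hf hfc
    _ ≤ 4096 * A ^ (4 - n) * (3 * B) ^ n := by gcongr
    _ ≤ 4096 * A ^ (4 - n) * (27 * B ^ n) := by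
        rw [mul_pow]
        gcongr
        rcases hn with rfl | rfl <;> norm_num
    _ ≤ 512 ^ 2 * (A ^ (4 - n) * B ^ n) := by
        have : 0 ≤ A ^ (4 - n) * B ^ n := by positivity
        linarith
    _ = (512 * (√A ^ (1 - (n : ℝ) / 4) * √B ^ ((n : ℝ) / 4)) ^ 4) ^ 2 := by
        have key : ∀ {D r : ℝ} {m : ℕ}, 0 ≤ D → r * 4 = m → ((√D ^ r) ^ 4) ^ 2 = D ^ m := by
          intro D r m hD hr
          rw [← Real.rpow_mul_natCast (Real.sqrt_nonneg D), Nat.cast_ofNat, hr,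
            Real.rpow_natCast, ← pow_mul, mul_comm, pow_mul, Real.sq_sqrt hD]
        rw [mul_pow, mul_pow, mul_pow, key (m := n) hB' (by ring), key (m := 4 - n) hA']
        rcases hn with rfl | rfl <;> norm_num

/-- Hölder's inequality with exponents `4, 4, 2`. -/
theorem integral_mul_mul_pow_four_le {X : Type*} [TopologicalSpace X] [MeasurableSpace X]
    [OpensMeasurableSpace X] {μ : Measure X} [IsFiniteMeasureOnCompacts μ] {f g h : X → ℝ}
    (hf : Continuous f) (hfc : HasCompactSupport f) (hg : Continuous g)
    (hgc : HasCompactSupport g) (hh : Continuous h) (hhc : HasCompactSupport h) :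
    (∫ x, f x * g x * h x ∂μ) ^ 4 ≤
      (∫ x, f x ^ 4 ∂μ) * (∫ x, g x ^ 4 ∂μ) * (∫ x, h x ^ 2 ∂μ) ^ 2 := by
  have h1 := sq_integral_mul_le (μ := μ) (f := fun x => f x * g x) (hf.mul hg)
    hfc.mul_right hh hhc
  have h2 := sq_integral_mul_le (μ := μ) (f := fun x => f x ^ 2) (g := fun x => g x ^ 2)
    (hf.pow 2) (hfc.comp_left (g := fun t : ℝ => t ^ 2) (by simp)) (hg.pow 2)
    (hgc.comp_left (g := fun t : ℝ => t ^ 2) (by simp))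
  simp only [← pow_mul, ← mul_pow, Nat.reduceMul] at h1 h2
  calc (∫ x, f x * g x * h x ∂μ) ^ 4 = ((∫ x, f x * g x * h x ∂μ) ^ 2) ^ 2 := by ring
    _ ≤ ((∫ x, (f x * g x) ^ 2 ∂μ) * ∫ x, h x ^ 2 ∂μ) ^ 2 := by gcongr
    _ = (∫ x, (f x * g x) ^ 2 ∂μ) ^ 2 * (∫ x, h x ^ 2 ∂μ) ^ 2 := by ring
    _ ≤ _ := by gcongr

theorem fderiv_coord_apply {n : ℕ} {u : (Fin n → ℝ) → (Fin n → ℝ)} (hu : Differentiable ℝ u)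
    (x y : Fin n → ℝ) (i : Fin n) : fderiv ℝ (fun x => u x i) x y = fderiv ℝ u x y i := by
  rw [fderiv_apply (hu x)]
  rfl

theorem integral_sq_coord_le {n : ℕ} {u : (Fin n → ℝ) → (Fin n → ℝ)} (hu : Continuous u)
    (huc : HasCompactSupport u) (i : Fin n) : ∫ x, u x i ^ 2 ≤ l2SqV u := by
  exact integral_mono
    (integrable_comp_of_hasCompactSupport hu huc (g := fun y => y i ^ 2) (by fun_prop) (by simp))
    (integrable_comp_of_hasCompactSupport hu huc (g := fun y => ∑ i, y i ^ 2) (by fun_prop)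
      (by simp))
    fun x => Finset.single_le_sum (f := fun i => u x i ^ 2) (fun j _ => sq_nonneg _)
      (Finset.mem_univ i)

theorem integral_sq_fderiv_coord_le {n : ℕ} {u : (Fin n → ℝ) → (Fin n → ℝ)}
    (hu : ContDiff ℝ 1 u) (huc : HasCompactSupport u) (i j : Fin n) :
    ∫ x, fderiv ℝ u x (Pi.single i 1) j ^ 2 ≤ gradSqV u := by
  have hc := hu.continuous_fderiv one_ne_zero
  refine integral_mono
    (integrable_comp_of_hasCompactSupport hc (huc.fderiv ℝ)
      (g := fun L => L (Pi.single i 1) j ^ 2) (by fun_prop) (by simp))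
    (integrable_comp_of_hasCompactSupport hc (huc.fderiv ℝ)
      (g := fun L => ∑ i, ∑ j, L (Pi.single i 1) j ^ 2) (by fun_prop) (by simp)) fun x => ?_
  dsimp only
  rw [← Finset.sum_product']
  exact Finset.single_le_sum (f := fun q : Fin n × Fin n => fderiv ℝ u x (Pi.single q.1 1) q.2 ^ 2)
    (fun _ _ => sq_nonneg _) (Finset.mem_univ (i, j))

theorem integral_sum_sq_fderiv_coord_le {n : ℕ} {u : (Fin n → ℝ) → (Fin n → ℝ)}
    (hu : ContDiff ℝ 1 u) (huc : HasCompactSupport u) (i : Fin n) :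
    ∫ x, ∑ k, fderiv ℝ (fun y => u y i) x (Pi.single k 1) ^ 2 ≤ gradSqV u := by
  simp_rw [fderiv_coord_apply (hu.differentiable one_ne_zero)]
  have hc := hu.continuous_fderiv one_ne_zero
  refine integral_mono
    (integrable_comp_of_hasCompactSupport hc (huc.fderiv ℝ)
      (g := fun L => ∑ k, L (Pi.single k 1) i ^ 2) (by fun_prop) (by simp))
    (integrable_comp_of_hasCompactSupport hc (huc.fderiv ℝ)
      (g := fun L => ∑ k, ∑ j, L (Pi.single k 1) j ^ 2) (by fun_prop) (by simp)) fun x => ?_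
  exact Finset.sum_le_sum fun k _ => Finset.single_le_sum
    (f := fun j => fderiv ℝ u x (Pi.single k 1) j ^ 2) (fun _ _ => sq_nonneg _)
    (Finset.mem_univ i)

theorem integral_sum_sq_fderiv_fderiv_coord_le {n : ℕ} {u : (Fin n → ℝ) → (Fin n → ℝ)}
    (hu : ContDiff ℝ 2 u) (huc : HasCompactSupport u) (i l : Fin n) :
    ∫ x, ∑ k, fderiv ℝ (fun y => fderiv ℝ u y (Pi.single i 1) l) x (Pi.single k 1) ^ 2
      ≤ hessSqV u := by
  have hu' : ContDiff ℝ 1 (fderiv ℝ u) := hu.fderiv_right (by norm_num)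
  have hc := hu'.continuous_fderiv one_ne_zero
  have h : ∀ (i l : Fin n) (x y : Fin n → ℝ),
      fderiv ℝ (fun y => fderiv ℝ u y (Pi.single i 1) l) x y
        = fderiv ℝ (fderiv ℝ u) x y (Pi.single i 1) l := fun i l x y => by
    rw [fderiv_coord_apply (hu'.differentiable one_ne_zero |>.clm_apply
        (differentiable_const _)),
      fderiv_clm_apply (hu'.differentiable one_ne_zero x) (differentiableAt_const _)]
    simp
  unfold hessSqV
  simp_rw [h]
  refine integral_mono
    (integrable_comp_of_hasCompactSupport hc ((huc.fderiv ℝ).fderiv ℝ)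
      (g := fun L => ∑ k, L (Pi.single k 1) (Pi.single i 1) l ^ 2) (by fun_prop) (by simp))
    (integrable_comp_of_hasCompactSupport hc ((huc.fderiv ℝ).fderiv ℝ)
      (g := fun L => ∑ i, ∑ k, ∑ l, L (Pi.single k 1) (Pi.single i 1) l ^ 2) (by fun_prop)
      (by simp)) fun x => ?_
  calc ∑ k, fderiv ℝ (fderiv ℝ u) x (Pi.single k 1) (Pi.single i 1) l ^ 2
      ≤ ∑ k, ∑ l, fderiv ℝ (fderiv ℝ u) x (Pi.single k 1) (Pi.single i 1) l ^ 2 :=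
        Finset.sum_le_sum fun k _ => Finset.single_le_sum
          (f := fun l => fderiv ℝ (fderiv ℝ u) x (Pi.single k 1) (Pi.single i 1) l ^ 2)
          (fun _ _ => sq_nonneg _) (Finset.mem_univ l)
    _ ≤ _ := Finset.single_le_sum
          (f := fun i => ∑ k, ∑ l, fderiv ℝ (fderiv ℝ u) x (Pi.single k 1) (Pi.single i 1) l ^ 2)
          (fun _ _ => by positivity) (Finset.mem_univ i)

/-- with `α = n/4`, `n ∈ {2,3}`, there is `c > 0` such that
`|b₁(u,v,w)| ≤ c ‖u‖_{L²}^{1−α} ‖u‖_{H¹}^{α} ‖∇v‖_{L²}^{1−α} ‖D²v‖_{L²}^{α} ‖w‖_{L²}`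
for all smooth compactly supported vector fields. -/
theorem b1_estimate_interpolated {n : ℕ} (hn : n = 2 ∨ n = 3) :
    ∃ c : ℝ, 0 < c ∧
      ∀ u v w : (Fin n → ℝ) → (Fin n → ℝ),
        ContDiff ℝ (⊤ : ℕ∞) u → HasCompactSupport u →
        ContDiff ℝ (⊤ : ℕ∞) v → HasCompactSupport v →
        ContDiff ℝ (⊤ : ℕ∞) w → HasCompactSupport w →
        |b1 u v w| ≤
          c * Real.sqrt (l2SqV u) ^ (1 - (n : ℝ) / 4) *
            Real.sqrt (l2SqV u + gradSqV u) ^ ((n : ℝ) / 4) *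
            Real.sqrt (gradSqV v) ^ (1 - (n : ℝ) / 4) *
            Real.sqrt (hessSqV v) ^ ((n : ℝ) / 4) *
            Real.sqrt (l2SqV w) := by
  refine ⟨207, by norm_num, fun u v w hu huc hv hvc hw hwc => ?_⟩
  have hu1 : ContDiff ℝ 1 u := contDiff_infty.1 hu 1
  have hv2 : ContDiff ℝ 2 v := contDiff_infty.1 hv 2
  have hv1 : ContDiff ℝ 1 v := hv2.of_le one_le_two
  have hdv : ContDiff ℝ 1 (fderiv ℝ v) := hv2.fderiv_right (by norm_num)
  have hl2u : 0 ≤ l2SqV u := integral_nonneg fun x => by positivity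
  have hl2w : 0 ≤ l2SqV w := integral_nonneg fun x => by positivity
  set P := √(l2SqV u) ^ (1 - (n : ℝ) / 4) * √(l2SqV u + gradSqV u) ^ ((n : ℝ) / 4)
    with hP
  set Q := √(gradSqV v) ^ (1 - (n : ℝ) / 4) * √(hessSqV v) ^ ((n : ℝ) / 4) with hQ
  have hP0 : 0 ≤ P := by positivity
  have hQ0 : 0 ≤ Q := by positivity
  have hterm : ∀ i j : Fin n,
      |∫ x, u x i * fderiv ℝ v x (Pi.single i 1) j * w x j| ≤ 23 * (P * Q * √(l2SqV w)) := by
    intro i j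
    have hui : ContDiff ℝ 1 fun x => u x i := contDiff_pi.1 hu1 i
    have huic : HasCompactSupport fun x => u x i :=
      huc.comp_left (g := fun y : Fin n → ℝ => y i) rfl
    have hwj : Continuous fun x => w x j := (continuous_apply j).comp hw.continuous
    have hwjc : HasCompactSupport fun x => w x j :=
      hwc.comp_left (g := fun y : Fin n → ℝ => y j) rfl
    have hvij : ContDiff ℝ 1 fun x => fderiv ℝ v x (Pi.single i 1) j :=
      contDiff_pi.1 (hdv.clm_apply contDiff_const) j
    have hvijc : HasCompactSupport fun x => fderiv ℝ v x (Pi.single i 1) j :=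
      (hvc.fderiv ℝ).comp_left
        (g := fun L : (Fin n → ℝ) →L[ℝ] (Fin n → ℝ) => L (Pi.single i 1) j) (by simp)
    have h4u : ∫ x, u x i ^ 4 ≤ 512 * P ^ 4 := integral_pow_four_le_of_le hn hui huic
      (integral_sq_coord_le hu1.continuous huc i)
      ((integral_sum_sq_fderiv_coord_le hu1 huc i).trans (le_add_of_nonneg_left hl2u))
    have h4v : ∫ x, fderiv ℝ v x (Pi.single i 1) j ^ 4 ≤ 512 * Q ^ 4 :=
      integral_pow_four_le_of_le hn hvij hvijc (integral_sq_fderiv_coord_le hv1 hvc i j)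
        (integral_sum_sq_fderiv_fderiv_coord_le hv2 hvc i j)
    have h2w : ∫ x, w x j ^ 2 ≤ √(l2SqV w) ^ 2 := by
      rw [Real.sq_sqrt hl2w]
      exact integral_sq_coord_le hw.continuous hwc j
    have h4v0 : 0 ≤ ∫ x, fderiv ℝ v x (Pi.single i 1) j ^ 4 :=
      integral_nonneg fun x => by positivity
    have h2w0 : 0 ≤ ∫ x, w x j ^ 2 := integral_nonneg fun x => by positivity
    refine le_of_pow_le_pow_left₀ four_ne_zero (by positivity) ?_
    rw [Even.pow_abs ⟨2, rfl⟩]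
    have h := integral_mul_mul_pow_four_le (μ := volume) hui.continuous huic hvij.continuous hvijc
      hwj hwjc
    refine h.trans ?_
    calc _ ≤ (512 * P ^ 4) * (512 * Q ^ 4) * (√(l2SqV w) ^ 2) ^ 2 := by gcongr
      _ = 262144 * (P * Q * √(l2SqV w)) ^ 4 := by ring
      _ ≤ 23 ^ 4 * (P * Q * √(l2SqV w)) ^ 4 := by gcongr; norm_num
      _ = _ := by ring
  calc |b1 u v w| ≤ ∑ _i : Fin n, ∑ _j : Fin n, 23 * (P * Q * √(l2SqV w)) :=
        (Finset.abs_sum_le_sum_abs _ _).trans (Finset.sum_le_sum fun i _ =>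
          (Finset.abs_sum_le_sum_abs _ _).trans (Finset.sum_le_sum fun j _ => hterm i j))
    _ = (n : ℝ) ^ 2 * 23 * (P * Q * √(l2SqV w)) := by simp; ring
    _ ≤ 207 * (P * Q * √(l2SqV w)) := by
        gcongr
        rcases hn with rfl | rfl <;> norm_num
    _ = _ := by rw [hP, hQ]; ring
end

section
/- Let n ∈ {2,3} and α = n/4. There exists a constant C > 0 such that for all smooth compactly supported vector fields x, y, w : ℝⁿ → ℝⁿ one has |b₁(y, y, w) − b₁(x, x, w)| ≤ C · ( ‖y − x‖_{H¹} · ‖y‖_{H¹}^{1−α} · ‖y‖_{H²}^{α} + ‖y − x‖_{H²}^{α} · ‖y − x‖_{H¹}^{1−α} · ‖x‖_{H¹} ) · ‖w‖_{L²}. In other words, the Navier–Stokes nonlinearity B(u) := B₁(u,u) satisfies the abstract local Lipschitz assumption with p = 1 and α = n/4. -/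
open MeasureTheory

/-- `‖u‖_{H¹}` of a vector field. -/
noncomputable def h1NormV {n : ℕ} (u : (Fin n → ℝ) → (Fin n → ℝ)) : ℝ :=
  Real.sqrt (l2SqV u + gradSqV u)

/-- `‖u‖_{H²}` of a vector field. -/
noncomputable def h2NormV {n : ℕ} (u : (Fin n → ℝ) → (Fin n → ℝ)) : ℝ :=
  Real.sqrt (l2SqV u + gradSqV u + hessSqV u)

theorem HasCompactSupport.of_imp_eq_zero {X A B : Type*} [TopologicalSpace X] [Zero A] [Zero B]
    {f : X → A} {g : X → B} (hf : HasCompactSupport f) (h : ∀ x, f x = 0 → g x = 0) :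
    HasCompactSupport g :=
  hf.mono fun x hx hfx => hx (h x hfx)

section CompactlySupported

variable {E : Type*} [TopologicalSpace E] [MeasurableSpace E] [OpensMeasurableSpace E]
  {μ : Measure E} [IsFiniteMeasureOnCompacts μ]

theorem integrable_sq_of_hasCompactSupport {f : E → ℝ} (hf : Continuous f)
    (hc : HasCompactSupport f) : Integrable (fun x => f x ^ 2) μ :=
  Continuous.integrable_of_hasCompactSupport (by fun_prop)
    (hc.of_imp_eq_zero fun x hx => by simp [hx])

theorem integrable_mul_mul_of_hasCompactSupport {f g h : E → ℝ} (hf : Continuous f)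
    (hg : Continuous g) (hh : Continuous h) (hc : HasCompactSupport h) :
    Integrable (fun x => f x * g x * h x) μ :=
  Continuous.integrable_of_hasCompactSupport (by fun_prop)
    (hc.of_imp_eq_zero fun x hx => by simp [hx])

/-- Cauchy–Schwarz for continuous compactly supported functions. -/
theorem integral_mul_sq_le {f g : E → ℝ} (hf : Continuous f) (hcf : HasCompactSupport f)
    (hg : Continuous g) (hcg : HasCompactSupport g) :
    (∫ x, f x * g x ∂μ) ^ 2 ≤ (∫ x, f x ^ 2 ∂μ) * ∫ x, g x ^ 2 ∂μ := by
  have hff : Integrable (fun x => f x ^ 2) μ := integrable_sq_of_hasCompactSupport hf hcf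
  have hgg : Integrable (fun x => g x ^ 2) μ := integrable_sq_of_hasCompactSupport hg hcg
  have hfg : Integrable (fun x => f x * g x) μ :=
    Continuous.integrable_of_hasCompactSupport (by fun_prop) (hcf.mul_right)
  have key : ∀ t : ℝ, 0 ≤ (∫ x, g x ^ 2 ∂μ) * (t * t) + (2 * ∫ x, f x * g x ∂μ) * t
      + ∫ x, f x ^ 2 ∂μ := by
    intro t
    have h : 0 ≤ ∫ x, (f x + t * g x) ^ 2 ∂μ := integral_nonneg fun x => sq_nonneg _
    have h' : ∫ x, (f x + t * g x) ^ 2 ∂μ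
        = ∫ x, (f x ^ 2 + (2 * t) * (f x * g x)) + (t * t) * g x ^ 2 ∂μ := by
      congr 1; ext x; ring
    rw [h', integral_add (f := fun x => f x ^ 2 + (2 * t) * (f x * g x))
      (hff.add (hfg.const_mul _)) (hgg.const_mul _),
      integral_add hff (hfg.const_mul _), integral_const_mul, integral_const_mul] at h
    linarith
  have := discrim_le_zero key
  rw [discrim] at this
  nlinarith

/-- The `L^k` norm of a continuous compactly supported function as a Bochner integral. -/
theorem eLpNorm_natCast_pow_eq_ofReal_integral {F : Type*} [NormedAddCommGroup F] {f : E → F}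
    (hf : Continuous f) (hc : HasCompactSupport f) {k : ℕ} (hk : k ≠ 0) :
    eLpNorm f ((k : NNReal) : ENNReal) μ ^ k = ENNReal.ofReal (∫ x, ‖f x‖ ^ k ∂μ) := by
  have hk' : (k : NNReal) ≠ 0 := by exact_mod_cast hk
  have h := eLpNorm_nnreal_pow_eq_lintegral (f := f) (μ := μ) hk'
  rw [NNReal.coe_natCast, ENNReal.rpow_natCast] at h
  rw [h, ofReal_integral_eq_lintegral_ofReal]
  · refine lintegral_congr fun x => ?_
    rw [← ofReal_norm, ENNReal.rpow_natCast, ENNReal.ofReal_pow (norm_nonneg _)]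
  · exact Continuous.integrable_of_hasCompactSupport (by fun_prop)
      (hc.of_imp_eq_zero fun x hx => by simp [hx, hk])
  · exact .of_forall fun x => by positivity

end CompactlySupported

/-- The dual norm for the sup norm is controlled by the Euclidean norm of the coordinates. -/
theorem norm_sq_le_card_mul_sum_apply_single_sq {n : ℕ} (L : (Fin n → ℝ) →L[ℝ] ℝ) :
    ‖L‖ ^ 2 ≤ n * ∑ i, L (Pi.single i 1) ^ 2 := by
  have h : ‖L‖ ≤ ∑ i, |L (Pi.single i 1)| := by
    refine L.opNorm_le_bound (Finset.sum_nonneg fun i _ => abs_nonneg _) fun v => ?_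
    have hv : L v = ∑ i, v i * L (Pi.single i 1) := by
      conv_lhs => rw [pi_eq_sum_univ' v]
      simp [map_sum]
    rw [hv, Finset.sum_mul]
    refine (Finset.abs_sum_le_sum_abs _ _).trans (Finset.sum_le_sum fun i _ => ?_)
    rw [abs_mul, mul_comm]
    gcongr
    exact norm_le_pi_norm v i
  calc ‖L‖ ^ 2 ≤ (∑ i, |L (Pi.single i 1)|) ^ 2 := by gcongr
    _ ≤ n * ∑ i, |L (Pi.single i 1)| ^ 2 := by
      simpa using sq_sum_le_card_mul_sum_sq (s := Finset.univ)
        (f := fun i => |L (Pi.single i 1)|)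
    _ = _ := by simp

theorem integral_norm_fderiv_sq_le {n : ℕ} {f : (Fin n → ℝ) → ℝ} (hf : ContDiff ℝ 1 f)
    (hc : HasCompactSupport f) :
    ∫ x, ‖fderiv ℝ f x‖ ^ 2 ≤ n * ∫ x, ∑ i, fderiv ℝ f x (Pi.single i 1) ^ 2 := by
  have hD : Continuous (fderiv ℝ f) := hf.continuous_fderiv one_ne_zero
  have hcD := hc.fderiv (𝕜 := ℝ)
  rw [← integral_const_mul]
  refine integral_mono ?_ ?_ fun x => norm_sq_le_card_mul_sum_apply_single_sq _
  · exact Continuous.integrable_of_hasCompactSupport (by fun_prop)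
      (hcD.of_imp_eq_zero fun x hx => by simp [hx])
  · exact Continuous.integrable_of_hasCompactSupport (by fun_prop)
      (hcD.of_imp_eq_zero fun x hx => by simp [hx])

theorem integral_pow_four_le_of_dim_two {f : (Fin 2 → ℝ) → ℝ} (hf : ContDiff ℝ 1 f)
    (hc : HasCompactSupport f) :
    ∫ x, f x ^ 4 ≤ 4 * (∫ x, f x ^ 2) * ∫ x, ‖fderiv ℝ f x‖ ^ 2 := by
  have hD : Continuous (fderiv ℝ f) := hf.continuous_fderiv one_ne_zero
  have hcD := hc.fderiv (𝕜 := ℝ)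
  have hdf : ∀ x, fderiv ℝ (fun x => f x ^ 2) x = (2 * f x) • fderiv ℝ f x := fun x => by
    simpa using (((hf.differentiable one_ne_zero x).hasFDerivAt).pow 2).fderiv
  have h := lintegral_pow_le_pow_lintegral_fderiv_aux (ι := Fin 2) (p := 2)
    (u := fun x => f x ^ 2) (by
      rw [Fintype.card_fin]; exact_mod_cast Real.HolderConjugate.two_two) (hf.pow 2)
    (hc.of_imp_eq_zero fun x hx => by simp [hx])
  have h1 : ∫⁻ x, ‖f x ^ 2‖ₑ ^ (2 : ℝ) = ENNReal.ofReal (∫ x, f x ^ 4) := by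
    rw [ofReal_integral_eq_lintegral_ofReal]
    · refine lintegral_congr fun x => ?_
      rw [Real.enorm_eq_ofReal (by positivity), ENNReal.ofReal_rpow_of_nonneg (by positivity)
        (by norm_num)]
      congr 1
      norm_cast
      ring
    · exact Continuous.integrable_of_hasCompactSupport (by fun_prop)
        (hc.of_imp_eq_zero fun x hx => by simp [hx])
    · exact .of_forall fun x => by positivity
  have h2 : ∫⁻ x, ‖fderiv ℝ (fun x => f x ^ 2) x‖ₑ
      = ENNReal.ofReal (2 * ∫ x, |f x| * ‖fderiv ℝ f x‖) := by
    rw [← integral_const_mul, ofReal_integral_eq_lintegral_ofReal]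
    · refine lintegral_congr fun x => ?_
      rw [hdf, ← ofReal_norm, norm_smul]
      simp [mul_assoc]
    · exact Continuous.integrable_of_hasCompactSupport (by have := hf.continuous; fun_prop)
        ((hcD.norm.mul_left (f := fun x => |f x|)).mul_left (f := fun _ => 2))
    · exact .of_forall fun x => by positivity
  have hI : 0 ≤ ∫ x, |f x| * ‖fderiv ℝ f x‖ := integral_nonneg fun x => by positivity
  rw [h1, h2, ENNReal.ofReal_rpow_of_nonneg (by positivity) (by norm_num),
    ENNReal.ofReal_le_ofReal_iff (by positivity)] at h
  have cs := integral_mul_sq_le (μ := volume) hf.continuous.abs hc.norm hD.norm hcD.norm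
  simp only [sq_abs] at cs
  norm_cast at h
  linarith [mul_pow 2 (∫ x, |f x| * ‖fderiv ℝ f x‖) 2]

theorem exists_integral_pow_six_le_of_dim_three : ∃ K : ℝ, 0 ≤ K ∧
    ∀ f : (Fin 3 → ℝ) → ℝ, ContDiff ℝ 1 f → HasCompactSupport f →
      ∫ x, f x ^ 6 ≤ K * (∫ x, ‖fderiv ℝ f x‖ ^ 2) ^ 3 := by
  let S : NNReal := eLpNormLESNormFDerivOfEqInnerConst (volume : Measure (Fin 3 → ℝ)) (2 : ℕ)
  refine ⟨(S : ℝ) ^ 6, by positivity, fun f hf hc => ?_⟩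
  have hD : Continuous (fderiv ℝ f) := hf.continuous_fderiv one_ne_zero
  have hcD := hc.fderiv (𝕜 := ℝ)
  have h := eLpNorm_le_eLpNorm_fderiv_of_eq_inner (volume : Measure (Fin 3 → ℝ)) hf hc
    (p := (2 : ℕ)) (p' := (6 : ℕ)) (by norm_num) (by simp) (by simp; norm_num)
  change _ ≤ (S : ENNReal) * _ at h
  have h6 := eLpNorm_natCast_pow_eq_ofReal_integral (μ := volume) hf.continuous hc
    (k := 6) (by norm_num)
  have h2 := eLpNorm_natCast_pow_eq_ofReal_integral (μ := volume) hD hcD (k := 2) (by norm_num)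
  have hI : 0 ≤ ∫ x, ‖fderiv ℝ f x‖ ^ 2 := integral_nonneg fun x => by positivity
  have h' := pow_le_pow_left' h 6
  rw [mul_pow, h6, show (6 : ℕ) = 2 * 3 by norm_num, pow_mul (eLpNorm (fderiv ℝ f) _ _), h2,
    ← ENNReal.ofReal_pow hI, ← ENNReal.ofReal_coe_nnreal,
    ← ENNReal.ofReal_pow (by positivity), ← ENNReal.ofReal_mul (by positivity),
    ENNReal.ofReal_le_ofReal_iff (by positivity)] at h'
  simpa [Even.pow_abs (show Even 6 by decide)] using h'

/-- **Ladyzhenskaya's inequality** in dimensions two and three. -/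
theorem exists_integral_pow_four_sq_le {n : ℕ} (hn : n = 2 ∨ n = 3) : ∃ K : ℝ, 1 ≤ K ∧
    ∀ f : (Fin n → ℝ) → ℝ, ContDiff ℝ 1 f → HasCompactSupport f →
      (∫ x, f x ^ 4) ^ 2 ≤ K * (∫ x, f x ^ 2) ^ (4 - n) *
        (∫ x, ∑ i, fderiv ℝ f x (Pi.single i 1) ^ 2) ^ n := by
  rcases hn with rfl | rfl
  · refine ⟨64, by norm_num, fun f hf hc => ?_⟩
    have h1 := integral_pow_four_le_of_dim_two hf hc
    have h2 := integral_norm_fderiv_sq_le hf hc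
    have h0 : 0 ≤ ∫ x, f x ^ 2 := integral_nonneg fun x => by positivity
    have h4 : 0 ≤ ∫ x, f x ^ 4 := integral_nonneg fun x => by positivity
    have h := pow_le_pow_left₀ h4
      (h1.trans (mul_le_mul_of_nonneg_left h2 (by positivity))) 2
    refine h.trans_eq ?_
    norm_num
    ring
  · obtain ⟨K, hK, h⟩ := exists_integral_pow_six_le_of_dim_three
    refine ⟨K * 27 + 1, by linarith, fun f hf hc => ?_⟩
    have h1 := h f hf hc
    have h2 := integral_norm_fderiv_sq_le hf hc
    have h0 : 0 ≤ ∫ x, f x ^ 2 := integral_nonneg fun x => by positivity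
    have hI : 0 ≤ ∫ x, ‖fderiv ℝ f x‖ ^ 2 := integral_nonneg fun x => by positivity
    have hJ : 0 ≤ ∫ x, ∑ i, fderiv ℝ f x (Pi.single i 1) ^ 2 :=
      integral_nonneg fun x => by positivity
    have cs := integral_mul_sq_le (μ := volume) (g := fun x => f x ^ 3) hf.continuous hc
      (hf.continuous.pow 3)
      (hc.of_imp_eq_zero fun x hx => by simp [hx])
    simp only [← pow_mul, ← pow_succ', Nat.reduceAdd, Nat.reduceMul] at cs
    have h3 := pow_le_pow_left₀ hI h2 3
    set J := ∫ x, ∑ i, fderiv ℝ f x (Pi.single i 1) ^ 2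
    calc (∫ x, f x ^ 4) ^ 2 ≤ (∫ x, f x ^ 2) * (K * ((3 : ℕ) * J) ^ 3) := by
          refine cs.trans (mul_le_mul_of_nonneg_left (h1.trans ?_) h0)
          gcongr
      _ ≤ _ := by
          have : 0 ≤ (∫ x, f x ^ 2) * J ^ 3 := by positivity
          norm_num
          linarith

/-- The fourth power of a trilinear integral is controlled by two `L⁴` norms and an `L²` norm. -/
theorem integral_mul_mul_pow_four_le_s15 {n : ℕ} {f g h : (Fin n → ℝ) → ℝ}
    (hf : Continuous f) (hcf : HasCompactSupport f) (hg : Continuous g)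
    (hcg : HasCompactSupport g) (hh : Continuous h) (hch : HasCompactSupport h) :
    (∫ x, f x * g x * h x) ^ 4 ≤
      (∫ x, f x ^ 4) * (∫ x, g x ^ 4) * (∫ x, h x ^ 2) ^ 2 := by
  have h1 := integral_mul_sq_le (μ := volume) (f := fun x => f x * g x)
    (hf.mul hg) hcf.mul_right hh hch
  have h2 := integral_mul_sq_le (μ := volume) (f := fun x => f x ^ 2) (g := fun x => g x ^ 2)
    (hf.pow 2)
    (hcf.of_imp_eq_zero fun x hx => by simp [hx]) (hg.pow 2)
    (hcg.of_imp_eq_zero fun x hx => by simp [hx])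
  simp only [← pow_mul, ← mul_pow, Nat.reduceMul] at h1 h2
  have h3 := pow_le_pow_left₀ (sq_nonneg _) h1 2
  rw [mul_pow, ← pow_mul] at h3
  exact h3.trans (by gcongr)

section VectorFields

variable {n : ℕ} {u v w : (Fin n → ℝ) → (Fin n → ℝ)}

theorem contDiff_fderiv_apply_coord (hu : ContDiff ℝ (⊤ : ℕ∞) u) (i j : Fin n) :
    ContDiff ℝ (⊤ : ℕ∞) (fun p => fderiv ℝ u p (Pi.single i 1) j) := by
  have h : ContDiff ℝ (⊤ : ℕ∞) (fderiv ℝ u) := hu.fderiv_right (by norm_cast)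
  exact contDiff_pi.1 (h.clm_apply contDiff_const) j

theorem hasCompactSupport_fderiv_apply_coord (hc : HasCompactSupport u) (i j : Fin n) :
    HasCompactSupport (fun p => fderiv ℝ u p (Pi.single i 1) j) :=
  (hc.fderiv (𝕜 := ℝ)).of_imp_eq_zero fun x hx => by simp [hx]

theorem hasCompactSupport_coord (hc : HasCompactSupport u) (j : Fin n) :
    HasCompactSupport (fun p => u p j) :=
  hc.of_imp_eq_zero fun x hx => by simp [hx]

theorem integrable_sq_coord (hu : Continuous u) (hc : HasCompactSupport u) (j : Fin n) :
    Integrable (fun x => u x j ^ 2) :=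
  integrable_sq_of_hasCompactSupport (continuous_pi_iff.1 hu j) (hasCompactSupport_coord hc j)

theorem integrable_sq_fderiv_coord (hu : ContDiff ℝ (⊤ : ℕ∞) u) (hc : HasCompactSupport u)
    (i j : Fin n) : Integrable (fun x => fderiv ℝ u x (Pi.single i 1) j ^ 2) :=
  integrable_sq_of_hasCompactSupport (contDiff_fderiv_apply_coord hu i j).continuous
    (hasCompactSupport_fderiv_apply_coord hc i j)

theorem integrable_sq_hess_coord (hu : ContDiff ℝ (⊤ : ℕ∞) u) (hc : HasCompactSupport u)
    (i j l : Fin n) : Integrable (fun x =>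
      fderiv ℝ (fun y => fderiv ℝ u y (Pi.single i 1) l) x (Pi.single j 1) ^ 2) := by
  have hD : Continuous (fderiv ℝ (fun y => fderiv ℝ u y (Pi.single i 1) l)) :=
    (contDiff_fderiv_apply_coord hu i l).continuous_fderiv (by simp)
  have hcD := (hasCompactSupport_fderiv_apply_coord hc i l).fderiv (𝕜 := ℝ)
  exact integrable_sq_of_hasCompactSupport (hD.clm_apply continuous_const)
    (hcD.of_imp_eq_zero fun x hx => by rw [hx]; rfl)

theorem l2SqV_nonneg : 0 ≤ l2SqV u := integral_nonneg fun x => by positivity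

theorem gradSqV_nonneg : 0 ≤ gradSqV u := integral_nonneg fun x => by positivity

theorem hessSqV_nonneg : 0 ≤ hessSqV u := integral_nonneg fun x => by positivity

theorem h1NormV_sq : h1NormV u ^ 2 = l2SqV u + gradSqV u :=
  Real.sq_sqrt (add_nonneg l2SqV_nonneg gradSqV_nonneg)

theorem h2NormV_sq : h2NormV u ^ 2 = l2SqV u + gradSqV u + hessSqV u :=
  Real.sq_sqrt (add_nonneg (add_nonneg l2SqV_nonneg gradSqV_nonneg) hessSqV_nonneg)

theorem integral_sq_coord_le_l2SqV (hu : Continuous u) (hc : HasCompactSupport u) (j : Fin n) :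
    ∫ x, u x j ^ 2 ≤ l2SqV u :=
  integral_mono (integrable_sq_coord hu hc j)
    (integrable_finsetSum _ fun j _ => integrable_sq_coord hu hc j)
    fun x => Finset.single_le_sum (f := fun j => u x j ^ 2)
      (fun _ _ => sq_nonneg _) (Finset.mem_univ j)

theorem integral_grad_coord_le_gradSqV (hu : ContDiff ℝ (⊤ : ℕ∞) u) (hc : HasCompactSupport u)
    (j : Fin n) :
    ∫ x, ∑ i, fderiv ℝ (fun p => u p j) x (Pi.single i 1) ^ 2 ≤ gradSqV u := by
  have he : ∀ x i, fderiv ℝ (fun p => u p j) x (Pi.single i 1)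
      = fderiv ℝ u x (Pi.single i 1) j := fun x i => by
    rw [fderiv_apply (hu.differentiable (by simp) x)]
    rfl
  simp only [he]
  refine integral_mono
    (integrable_finsetSum _ fun i _ => integrable_sq_fderiv_coord hu hc i j)
    (integrable_finsetSum _ fun i _ => integrable_finsetSum _ fun j _ =>
      integrable_sq_fderiv_coord hu hc i j) fun x => Finset.sum_le_sum fun i _ => ?_
  exact Finset.single_le_sum (f := fun j => fderiv ℝ u x (Pi.single i 1) j ^ 2)
    (fun _ _ => sq_nonneg _) (Finset.mem_univ j)

theorem integral_sq_fderiv_coord_le_gradSqV (hu : ContDiff ℝ (⊤ : ℕ∞) u)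
    (hc : HasCompactSupport u) (i j : Fin n) :
    ∫ x, fderiv ℝ u x (Pi.single i 1) j ^ 2 ≤ gradSqV u := by
  refine integral_mono (integrable_sq_fderiv_coord hu hc i j)
    (integrable_finsetSum _ fun i _ => integrable_finsetSum _ fun j _ =>
      integrable_sq_fderiv_coord hu hc i j) fun x => ?_
  refine (Finset.single_le_sum (f := fun j => fderiv ℝ u x (Pi.single i 1) j ^ 2)
    (fun _ _ => sq_nonneg _) (Finset.mem_univ j)).trans ?_
  exact Finset.single_le_sum (f := fun i => ∑ j, fderiv ℝ u x (Pi.single i 1) j ^ 2)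
    (fun _ _ => by positivity) (Finset.mem_univ i)

theorem integral_grad_fderiv_coord_le_hessSqV (hu : ContDiff ℝ (⊤ : ℕ∞) u)
    (hc : HasCompactSupport u) (i l : Fin n) :
    ∫ x, ∑ j, fderiv ℝ (fun y => fderiv ℝ u y (Pi.single i 1) l) x (Pi.single j 1) ^ 2
      ≤ hessSqV u := by
  refine integral_mono
    (integrable_finsetSum _ fun j _ => integrable_sq_hess_coord hu hc i j l)
    (integrable_finsetSum _ fun i _ => integrable_finsetSum _ fun j _ =>
      integrable_finsetSum _ fun l _ => integrable_sq_hess_coord hu hc i j l) fun x => ?_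
  refine (Finset.sum_le_sum fun j _ => Finset.single_le_sum
    (f := fun l => fderiv ℝ (fun y => fderiv ℝ u y (Pi.single i 1) l) x (Pi.single j 1) ^ 2)
    (fun _ _ => sq_nonneg _) (Finset.mem_univ l)).trans ?_
  exact Finset.single_le_sum (f := fun i => ∑ j, ∑ l,
    fderiv ℝ (fun y => fderiv ℝ u y (Pi.single i 1) l) x (Pi.single j 1) ^ 2)
    (fun _ _ => by positivity) (Finset.mem_univ i)

theorem interpolated_norm_pow_eight (hn : n ≤ 4) {a b : ℝ} (ha : 0 ≤ a) (hb : 0 ≤ b) :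
    (a ^ (1 - (n : ℝ) / 4) * b ^ ((n : ℝ) / 4)) ^ 8 = (a ^ 2) ^ (4 - n) * (b ^ 2) ^ n := by
  have ea : (a ^ (1 - (n : ℝ) / 4)) ^ 8 = (a ^ 2) ^ (4 - n) := by
    rw [← pow_mul, ← Real.rpow_mul_natCast ha, ← Real.rpow_natCast a]
    congr 1
    push_cast [Nat.cast_sub hn]
    ring
  have eb : (b ^ ((n : ℝ) / 4)) ^ 8 = (b ^ 2) ^ n := by
    rw [← pow_mul, ← Real.rpow_mul_natCast hb, ← Real.rpow_natCast b]
    congr 1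
    push_cast
    ring
  rw [mul_pow, ea, eb]

/-- The basic trilinear estimate for `b₁`. -/
theorem exists_abs_b1_le (hn : n = 2 ∨ n = 3) : ∃ C : ℝ, 0 < C ∧
    ∀ u v w : (Fin n → ℝ) → (Fin n → ℝ),
      ContDiff ℝ (⊤ : ℕ∞) u → HasCompactSupport u →
      ContDiff ℝ (⊤ : ℕ∞) v → HasCompactSupport v →
      ContDiff ℝ (⊤ : ℕ∞) w → HasCompactSupport w →
      |b1 u v w| ≤ C * (h1NormV u * (h1NormV v ^ (1 - (n : ℝ) / 4) * h2NormV v ^ ((n : ℝ) / 4))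
        * Real.sqrt (l2SqV w)) := by
  obtain ⟨K, hK, hL⟩ := exists_integral_pow_four_sq_le hn
  have hn4 : n ≤ 4 := by omega
  have hn0 : 0 < n := by omega
  refine ⟨n * (n * K), by positivity, fun u v w hu hcu hv hcv hw hcw => ?_⟩
  have hA : 0 ≤ h1NormV u := Real.sqrt_nonneg _
  have hB : 0 ≤ h1NormV v := Real.sqrt_nonneg _
  have hB' : 0 ≤ h2NormV v := Real.sqrt_nonneg _
  have hW : 0 ≤ Real.sqrt (l2SqV w) := Real.sqrt_nonneg _
  set R := h1NormV u * (h1NormV v ^ (1 - (n : ℝ) / 4) * h2NormV v ^ ((n : ℝ) / 4))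
        * Real.sqrt (l2SqV w) with hR
  have hR0 : 0 ≤ R := by positivity
  have term : ∀ i j, |∫ x, u x i * fderiv ℝ v x (Pi.single i 1) j * w x j| ≤ K * R := by
    intro i j
    have hui : ContDiff ℝ (⊤ : ℕ∞) (fun p => u p i) := contDiff_pi.1 hu i
    have hcui : HasCompactSupport (fun p => u p i) :=
      hasCompactSupport_coord hcu i
    have hcwj : HasCompactSupport (fun p => w p j) :=
      hasCompactSupport_coord hcw j
    have hd := contDiff_fderiv_apply_coord hv i j
    have hcd := hasCompactSupport_fderiv_apply_coord hcv i j
    have hT := integral_mul_mul_pow_four_le_s15 hui.continuous hcui hd.continuous hcd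
      (contDiff_pi.1 hw j).continuous hcwj
    have h1 := hL _ (hui.of_le (by norm_cast)) hcui
    have h2 := hL _ (hd.of_le (by norm_cast)) hcd
    have bu : ∫ x, u x i ^ 2 ≤ h1NormV u ^ 2 := by
      rw [h1NormV_sq]
      linarith [integral_sq_coord_le_l2SqV hu.continuous hcu i, gradSqV_nonneg (u := u)]
    have bgu : ∫ x, ∑ k, fderiv ℝ (fun p => u p i) x (Pi.single k 1) ^ 2 ≤ h1NormV u ^ 2 := by
      rw [h1NormV_sq]
      linarith [integral_grad_coord_le_gradSqV hu hcu i, l2SqV_nonneg (u := u)]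
    have bv : ∫ x, fderiv ℝ v x (Pi.single i 1) j ^ 2 ≤ h1NormV v ^ 2 := by
      rw [h1NormV_sq]
      linarith [integral_sq_fderiv_coord_le_gradSqV hv hcv i j, l2SqV_nonneg (u := v)]
    have bgv : ∫ x, ∑ k, fderiv ℝ (fun y => fderiv ℝ v y (Pi.single i 1) j) x
        (Pi.single k 1) ^ 2 ≤ h2NormV v ^ 2 := by
      rw [h2NormV_sq]
      linarith [integral_grad_fderiv_coord_le_hessSqV hv hcv i j, l2SqV_nonneg (u := v),
        gradSqV_nonneg (u := v)]
    have bw : ∫ x, w x j ^ 2 ≤ Real.sqrt (l2SqV w) ^ 2 := by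
      rw [Real.sq_sqrt l2SqV_nonneg]
      exact integral_sq_coord_le_l2SqV hw.continuous hcw j
    have nn : ∀ (f : (Fin n → ℝ) → ℝ), 0 ≤ ∫ x, f x ^ 2 :=
      fun f => integral_nonneg fun x => sq_nonneg _
    have nng : ∀ (f : (Fin n → ℝ) → ℝ), 0 ≤ ∫ x, ∑ k, fderiv ℝ f x (Pi.single k 1) ^ 2 :=
      fun f => integral_nonneg fun x => by positivity
    have h1' : (∫ x, u x i ^ 4) ^ 2 ≤ K * (h1NormV u) ^ 8 := by
      calc _ ≤ K * (h1NormV u ^ 2) ^ (4 - n) * (h1NormV u ^ 2) ^ n := by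
            refine h1.trans ?_
            have := nn (fun x => u x i)
            have := nng (fun x => u x i)
            gcongr
        _ = _ := by
            rw [mul_assoc, ← pow_add, Nat.sub_add_cancel hn4, ← pow_mul]
    have h2' : (∫ x, fderiv ℝ v x (Pi.single i 1) j ^ 4) ^ 2 ≤
        K * ((h1NormV v ^ 2) ^ (4 - n) * (h2NormV v ^ 2) ^ n) := by
      rw [← mul_assoc]
      refine h2.trans ?_
      have := nn (fun x => fderiv ℝ v x (Pi.single i 1) j)
      have := nng (fun x => fderiv ℝ v x (Pi.single i 1) j)
      gcongr
    rw [← interpolated_norm_pow_eight hn4 hB hB'] at h2'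
    have hT8 := pow_le_pow_left₀ (by positivity) hT 2
    refine le_of_pow_le_pow_left₀ (n := 8) (by norm_num) (by positivity) ?_
    calc _ = ((∫ x, u x i * fderiv ℝ v x (Pi.single i 1) j * w x j) ^ 4) ^ 2 := by
          rw [← pow_mul, Even.pow_abs (by decide)]
      _ ≤ (∫ x, u x i ^ 4) ^ 2 * (∫ x, fderiv ℝ v x (Pi.single i 1) j ^ 4) ^ 2 *
            ((∫ x, w x j ^ 2) ^ 2) ^ 2 := by
          rw [← mul_pow, ← mul_pow]; exact hT8
      _ ≤ (K * (h1NormV u) ^ 8) *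
            (K * (h1NormV v ^ (1 - (n : ℝ) / 4) * h2NormV v ^ ((n : ℝ) / 4)) ^ 8) *
            ((Real.sqrt (l2SqV w) ^ 2) ^ 2) ^ 2 := by
          have := nn (fun x => w x j)
          gcongr
      _ = K ^ 2 * R ^ 8 := by rw [hR]; ring
      _ ≤ K ^ 8 * R ^ 8 := by
          gcongr
          norm_num
      _ = (K * R) ^ 8 := by ring
  calc |b1 u v w| ≤ ∑ i : Fin n, ∑ j : Fin n, K * R := by
        refine (Finset.abs_sum_le_sum_abs _ _).trans (Finset.sum_le_sum fun i _ => ?_)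
        exact (Finset.abs_sum_le_sum_abs _ _).trans (Finset.sum_le_sum fun j _ => term i j)
    _ = n * (n * K) * R := by
        simp
        ring

theorem integrable_b1_integrand (hu : Continuous u) (hv : ContDiff ℝ (⊤ : ℕ∞) v)
    (hw : Continuous w) (hcw : HasCompactSupport w) (i j : Fin n) :
    Integrable (fun x => u x i * fderiv ℝ v x (Pi.single i 1) j * w x j) :=
  integrable_mul_mul_of_hasCompactSupport (continuous_pi_iff.1 hu i)
    (contDiff_fderiv_apply_coord hv i j).continuous (continuous_pi_iff.1 hw j)
    (hasCompactSupport_coord hcw j)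

theorem b1_self_sub_b1_self {x y : (Fin n → ℝ) → (Fin n → ℝ)} (hx : ContDiff ℝ (⊤ : ℕ∞) x)
    (hy : ContDiff ℝ (⊤ : ℕ∞) y) (hw : Continuous w) (hcw : HasCompactSupport w) :
    b1 y y w - b1 x x w =
      b1 (fun p => y p - x p) y w + b1 x (fun p => y p - x p) w := by
  have he := hy.sub hx
  simp only [b1, ← Finset.sum_sub_distrib, ← Finset.sum_add_distrib]
  refine Finset.sum_congr rfl fun i _ => Finset.sum_congr rfl fun j _ => ?_
  rw [← integral_sub (integrable_b1_integrand hy.continuous hy hw hcw i j)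
      (integrable_b1_integrand hx.continuous hx hw hcw i j),
    ← integral_add (integrable_b1_integrand he.continuous hy hw hcw i j)
      (integrable_b1_integrand hx.continuous he hw hcw i j)]
  refine integral_congr_ae (.of_forall fun p => ?_)
  have hf : fderiv ℝ (fun p => y p - x p) p = fderiv ℝ y p - fderiv ℝ x p :=
    fderiv_fun_sub (hy.differentiable (by simp) p) (hx.differentiable (by simp) p)
  simp only [hf, Pi.sub_apply, sub_apply]
  ring

end VectorFields

/-- with `α = n/4`, `n ∈ {2,3}`, the Navier–Stokes nonlinearity
`u ↦ B₁(u,u)` satisfies the abstract local Lipschitz estimate (tested against `w`):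
`|b₁(y,y,w) − b₁(x,x,w)|
  ≤ C (‖y−x‖_{H¹} ‖y‖_{H¹}^{1−α} ‖y‖_{H²}^{α} + ‖y−x‖_{H²}^{α} ‖y−x‖_{H¹}^{1−α} ‖x‖_{H¹})
      ‖w‖_{L²}`. -/
theorem b1_local_lipschitz {n : ℕ} (hn : n = 2 ∨ n = 3) :
    ∃ C : ℝ, 0 < C ∧
      ∀ x y w : (Fin n → ℝ) → (Fin n → ℝ),
        ContDiff ℝ (⊤ : ℕ∞) x → HasCompactSupport x →
        ContDiff ℝ (⊤ : ℕ∞) y → HasCompactSupport y →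
        ContDiff ℝ (⊤ : ℕ∞) w → HasCompactSupport w →
        |b1 y y w - b1 x x w| ≤
          C * (h1NormV (fun p => y p - x p) *
                h1NormV y ^ (1 - (n : ℝ) / 4) * h2NormV y ^ ((n : ℝ) / 4)
              + h2NormV (fun p => y p - x p) ^ ((n : ℝ) / 4) *
                h1NormV (fun p => y p - x p) ^ (1 - (n : ℝ) / 4) * h1NormV x) *
            Real.sqrt (l2SqV w) := by
  obtain ⟨C, hC, h⟩ := exists_abs_b1_le hn
  refine ⟨C, hC, fun x y w hx hcx hy hcy hw hcw => ?_⟩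
  have he : ContDiff ℝ (⊤ : ℕ∞) (fun p => y p - x p) := hy.sub hx
  have hce : HasCompactSupport (fun p => y p - x p) := hcy.sub hcx
  rw [b1_self_sub_b1_self hx hy hw.continuous hcw]
  refine (abs_add_le _ _).trans ((add_le_add (h _ _ _ he hce hy hcy hw hcw)
    (h _ _ _ hx hcx he hce hw hcw)).trans_eq ?_)
  ring
end
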